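/- arXiv:2305.06003 — 7 statements merged into one kernel-verified Lean document; each statement's English description precedes it below -/
import Mathlib

section
/- Let A be an invertible n×n real matrix, B an n×m real matrix, Q an n×n real symmetric positive semidefinite matrix, and R an m×m real symmetric positive definite matrix. Define E := Aᵀ + Q A⁻¹ B R⁻¹ Bᵀ, F := Q A⁻¹, G := A⁻¹ B R⁻¹ Bᵀ, H := A⁻¹. Then for every n×n symmetric positive semidefinite matrix P, the matrix G P + H is invertible and the Riccati operator satisfies R(P) = (E P + F)(G P + H)⁻¹. -/
open Matrix

/-- The Riccati correction satisfies `X (1 + B R⁻¹ Bᵀ P) = P`, where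
`X = P − P B (R + Bᵀ P B)⁻¹ Bᵀ P`. -/
theorem riccati_correction_mul {ι κ K : Type*} [Fintype ι] [DecidableEq ι] [Fintype κ]
    [DecidableEq κ] [CommRing K] (B : Matrix ι κ K) (R : Matrix κ κ K) (P : Matrix ι ι K)
    (hR : IsUnit R.det) (hW : IsUnit (R + Bᵀ * P * B).det) :
    (P - P * B * (R + Bᵀ * P * B)⁻¹ * Bᵀ * P) * (1 + B * (R⁻¹ * Bᵀ * P)) = P := by
  have h : Bᵀ * P * (1 + B * (R⁻¹ * Bᵀ * P)) = (R + Bᵀ * P * B) * (R⁻¹ * Bᵀ * P) := by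
    have hRR : R * (R⁻¹ * Bᵀ * P) = Bᵀ * P := by
      rw [Matrix.mul_assoc R⁻¹, mul_nonsing_inv_cancel_left _ _ hR]
    rw [Matrix.add_mul, hRR, Matrix.mul_add, Matrix.mul_one, Matrix.mul_assoc _ B]
  have h' : P * B * (R + Bᵀ * P * B)⁻¹ * Bᵀ * P * (1 + B * (R⁻¹ * Bᵀ * P)) =
      P * B * (R⁻¹ * Bᵀ * P) := by
    rw [Matrix.mul_assoc (P * B * _) Bᵀ P, Matrix.mul_assoc (P * B * _) (Bᵀ * P), h,
      Matrix.mul_assoc (P * B), nonsing_inv_mul_cancel_left _ _ hW]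
  rw [Matrix.sub_mul, h', Matrix.mul_add, Matrix.mul_one, Matrix.mul_assoc P B,
    add_sub_cancel_right]

/-- `1 + B R⁻¹ Bᵀ P` is invertible as soon as `R` and `R + Bᵀ P B` are. -/
theorem isUnit_det_one_add_mul_inv_mul {ι κ K : Type*} [Fintype ι] [DecidableEq ι] [Fintype κ]
    [DecidableEq κ] [CommRing K] (B : Matrix ι κ K) (R : Matrix κ κ K) (P : Matrix ι ι K)
    (hR : IsUnit R.det) (hW : IsUnit (R + Bᵀ * P * B).det) :
    IsUnit (1 + B * (R⁻¹ * Bᵀ * P)).det := by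
  have h : 1 + R⁻¹ * Bᵀ * P * B = R⁻¹ * (R + Bᵀ * P * B) := by
    rw [Matrix.mul_add, nonsing_inv_mul _ hR]
    simp only [Matrix.mul_assoc]
  rw [det_one_add_mul_comm, h, det_mul]
  exact (isUnit_nonsing_inv_det _ hR).mul hW

/-- For invertible `A`, the Riccati operator
`R(P) = Q + Aᵀ(P − P B (R + Bᵀ P B)⁻¹ Bᵀ P) A` can be written as the linear fractional
transformation `(E P + F)(G P + H)⁻¹` with `E = Aᵀ + Q A⁻¹ B R⁻¹ Bᵀ`, `F = Q A⁻¹`,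
`G = A⁻¹ B R⁻¹ Bᵀ`, `H = A⁻¹`, and `G P + H` is invertible. -/
theorem riccati_linear_fractional {n m : ℕ}
    (A Q : Matrix (Fin n) (Fin n) ℝ) (B : Matrix (Fin n) (Fin m) ℝ)
    (R : Matrix (Fin m) (Fin m) ℝ)
    (hA : IsUnit A.det) (hQ : Q.PosSemidef) (hR : R.PosDef)
    (P : Matrix (Fin n) (Fin n) ℝ) (hP : P.PosSemidef) :
    IsUnit ((A⁻¹ * B * R⁻¹ * Bᵀ) * P + A⁻¹).det ∧
      Q + Aᵀ * (P - P * B * (R + Bᵀ * P * B)⁻¹ * Bᵀ * P) * A =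
        ((Aᵀ + Q * A⁻¹ * B * R⁻¹ * Bᵀ) * P + Q * A⁻¹) *
          ((A⁻¹ * B * R⁻¹ * Bᵀ) * P + A⁻¹)⁻¹ := by
  have hRu : IsUnit R.det := hR.det_pos.ne'.isUnit
  have hW : IsUnit (R + Bᵀ * P * B).det := by
    have h := hR.add_posSemidef (hP.conjTranspose_mul_mul_same B)
    rw [conjTranspose_eq_transpose_of_trivial] at h
    exact h.det_pos.ne'.isUnit
  have hfac : A⁻¹ * B * R⁻¹ * Bᵀ * P + A⁻¹ = A⁻¹ * (1 + B * (R⁻¹ * Bᵀ * P)) := by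
    rw [Matrix.mul_add, Matrix.mul_one, add_comm]
    simp only [Matrix.mul_assoc]
  have hdet : IsUnit (A⁻¹ * B * R⁻¹ * Bᵀ * P + A⁻¹).det := by
    rw [hfac, det_mul]
    exact (isUnit_nonsing_inv_det _ hA).mul (isUnit_det_one_add_mul_inv_mul B R P hRu hW)
  refine ⟨hdet, ?_⟩
  have hmul : (Q + Aᵀ * (P - P * B * (R + Bᵀ * P * B)⁻¹ * Bᵀ * P) * A) *
      (A⁻¹ * B * R⁻¹ * Bᵀ * P + A⁻¹) =
        (Aᵀ + Q * A⁻¹ * B * R⁻¹ * Bᵀ) * P + Q * A⁻¹ := by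
    rw [hfac, Matrix.add_mul, Matrix.mul_assoc _ A, mul_nonsing_inv_cancel_left _ _ hA,
      Matrix.mul_assoc Aᵀ, riccati_correction_mul B R P hRu hW]
    simp only [Matrix.mul_add, Matrix.add_mul, Matrix.mul_one, Matrix.mul_assoc]
    abel
  rw [← hmul, mul_nonsing_inv_cancel_right _ _ hdet]
end

section
/- Let A be an invertible n×n real matrix, B an n×m real matrix, Q an n×n real symmetric positive semidefinite matrix, and R an m×m real symmetric positive definite matrix. With E := Aᵀ + Q A⁻¹ B R⁻¹ Bᵀ and G := A⁻¹ B R⁻¹ Bᵀ, the identity Eᵀ G = B (R⁻¹ + R⁻¹ Bᵀ (Aᵀ)⁻¹ Q A⁻¹ B R⁻¹) Bᵀ holds; consequently Eᵀ G is symmetric positive semidefinite, and if B has full row rank (rank B = n) then Eᵀ G is positive definite. -/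
open Matrix

/-- With `E = Aᵀ + Q A⁻¹ B R⁻¹ Bᵀ` and `G = A⁻¹ B R⁻¹ Bᵀ`, one has
`Eᵀ G = B (R⁻¹ + R⁻¹ Bᵀ (Aᵀ)⁻¹ Q A⁻¹ B R⁻¹) Bᵀ`; hence `Eᵀ G` is symmetric positive
semidefinite, and positive definite whenever `B` has full row rank. -/
theorem EtG_identity_posSemidef {n m : ℕ}
    (A Q : Matrix (Fin n) (Fin n) ℝ) (B : Matrix (Fin n) (Fin m) ℝ)
    (R : Matrix (Fin m) (Fin m) ℝ)
    (hA : IsUnit A.det) (hQ : Q.PosSemidef) (hR : R.PosDef) :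
    (Aᵀ + Q * A⁻¹ * B * R⁻¹ * Bᵀ)ᵀ * (A⁻¹ * B * R⁻¹ * Bᵀ) =
        B * (R⁻¹ + R⁻¹ * Bᵀ * Aᵀ⁻¹ * Q * A⁻¹ * B * R⁻¹) * Bᵀ ∧
      ((Aᵀ + Q * A⁻¹ * B * R⁻¹ * Bᵀ)ᵀ * (A⁻¹ * B * R⁻¹ * Bᵀ)).PosSemidef ∧
      (B.rank = n →
        ((Aᵀ + Q * A⁻¹ * B * R⁻¹ * Bᵀ)ᵀ * (A⁻¹ * B * R⁻¹ * Bᵀ)).PosDef) := by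
  have hRt : (R⁻¹)ᵀ = R⁻¹ := by
    simpa [IsHermitian, conjTranspose_eq_transpose_of_trivial] using hR.inv.isHermitian
  have hQt : Qᵀ = Q := by
    simpa [IsHermitian, conjTranspose_eq_transpose_of_trivial] using hQ.isHermitian
  have hid : (Aᵀ + Q * A⁻¹ * B * R⁻¹ * Bᵀ)ᵀ * (A⁻¹ * B * R⁻¹ * Bᵀ) =
      B * (R⁻¹ + R⁻¹ * Bᵀ * Aᵀ⁻¹ * Q * A⁻¹ * B * R⁻¹) * Bᵀ := by
    simp only [transpose_add, transpose_mul, transpose_transpose, hRt, hQt,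
      transpose_nonsing_inv, Matrix.add_mul, Matrix.mul_add, Matrix.mul_assoc,
      mul_nonsing_inv_cancel_left A _ hA]
  have hmid : (R⁻¹ + R⁻¹ * Bᵀ * Aᵀ⁻¹ * Q * A⁻¹ * B * R⁻¹).PosDef := by
    refine hR.inv.add_posSemidef ?_
    have h := hQ.conjTranspose_mul_mul_same (A⁻¹ * B * R⁻¹)
    simpa only [conjTranspose_eq_transpose_of_trivial, transpose_mul, hRt,
      transpose_nonsing_inv, Matrix.mul_assoc] using h
  refine ⟨hid, ?_, fun hB => ?_⟩
  · rw [hid]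
    simpa only [conjTranspose_eq_transpose_of_trivial] using
      hmid.posSemidef.mul_mul_conjTranspose_same B
  · have hrow : LinearIndependent ℝ B.row := by
      rw [linearIndependent_iff_card_eq_finrank_span, Fintype.card_fin, Set.finrank,
        ← rank_eq_finrank_span_row, hB]
    rw [hid]
    simpa only [conjTranspose_eq_transpose_of_trivial] using
      hmid.mul_mul_conjTranspose_same (vecMul_injective_iff.2 hrow)
end

section
/- Let A be an invertible n×n real matrix, B an n×m real matrix, Q an n×n real symmetric positive semidefinite matrix, and R an m×m real symmetric positive definite matrix. Then for every n×n symmetric positive definite matrix P, the Riccati operator satisfies R(P) = Q + Aᵀ (P⁻¹ + B R⁻¹ Bᵀ)⁻¹ A, and R(P) is symmetric positive definite. -/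
open Matrix

/-- For symmetric positive definite `P`, the Riccati operator satisfies
`R(P) = Q + Aᵀ (P⁻¹ + B R⁻¹ Bᵀ)⁻¹ A`, and `R(P)` is symmetric positive definite. -/
theorem riccati_inverse_form_posDef {n m : ℕ}
    (A Q : Matrix (Fin n) (Fin n) ℝ) (B : Matrix (Fin n) (Fin m) ℝ)
    (R : Matrix (Fin m) (Fin m) ℝ)
    (hA : IsUnit A.det) (hQ : Q.PosSemidef) (hR : R.PosDef)
    (P : Matrix (Fin n) (Fin n) ℝ) (hP : P.PosDef) :
    Q + Aᵀ * (P - P * B * (R + Bᵀ * P * B)⁻¹ * Bᵀ * P) * A =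
        Q + Aᵀ * (P⁻¹ + B * R⁻¹ * Bᵀ)⁻¹ * A ∧
      (Q + Aᵀ * (P - P * B * (R + Bᵀ * P * B)⁻¹ * Bᵀ * P) * A).PosDef := by
  have hS : (R + Bᵀ * P * B).PosDef := by
    simpa using hR.add_posSemidef (hP.posSemidef.conjTranspose_mul_mul_same B)
  have hT : (P⁻¹ + B * R⁻¹ * Bᵀ).PosDef := by
    simpa using hP.inv.add_posSemidef (hR.inv.posSemidef.mul_mul_conjTranspose_same B)
  have hPP : P⁻¹⁻¹ = P := nonsing_inv_nonsing_inv P ((isUnit_iff_isUnit_det P).mp hP.isUnit)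
  have hRR : R⁻¹⁻¹ = R := nonsing_inv_nonsing_inv R ((isUnit_iff_isUnit_det R).mp hR.isUnit)
  have woodbury : P - P * B * (R + Bᵀ * P * B)⁻¹ * Bᵀ * P = (P⁻¹ + B * R⁻¹ * Bᵀ)⁻¹ := by
    have h := add_mul_mul_inv_eq_sub P⁻¹ B R⁻¹ Bᵀ hP.inv.isUnit hR.inv.isUnit
      (by simpa only [hPP, hRR] using hS.isUnit)
    simpa only [hPP, hRR] using h.symm
  rw [woodbury]
  refine ⟨rfl, PosDef.posSemidef_add hQ ?_⟩
  have hA' : Function.Injective A.mulVec :=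
    mulVec_injective_of_isUnit ((isUnit_iff_isUnit_det A).mpr hA)
  simpa using hT.inv.conjTranspose_mul_mul_same hA'
end

section
/- For any two n×n real symmetric positive definite matrices U and V, all eigenvalues of U V⁻¹ are real and positive, and the function δ(U,V) := (∑_{i=1}^{n} (log λ_i)²)^{1/2}, where λ_1,…,λ_n are the eigenvalues of U V⁻¹ counted with multiplicity, defines a metric on the set of n×n symmetric positive definite matrices: δ(U,V) ≥ 0 with equality if and only if U = V, δ(U,V) = δ(V,U), and δ(U,W) ≤ δ(U,V) + δ(V,W) for all symmetric positive definite U, V, W. -/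
open Matrix

/-- The Riemannian distance on positive definite matrices:
`δ(U,V) = sqrt (∑ (log λᵢ)²)` where `λ₁,…,λₙ` are the eigenvalues of `U V⁻¹`
(the roots, with multiplicity, of its characteristic polynomial). -/
noncomputable def riemannianDist {n : ℕ} (U V : Matrix (Fin n) (Fin n) ℝ) : ℝ :=
  Real.sqrt ((((U * V⁻¹).charpoly.roots).map fun μ => (Real.log μ) ^ 2).sum)

namespace Matrix

variable {ι : Type*} [Fintype ι] [DecidableEq ι]

theorem trace_conj_diagonal (P : Matrix ι ι ℝ) (a : ι → ℝ) :
    (P * diagonal a * Pᵀ).trace = ∑ j, a j * (Pᵀ * P) j j := by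
  rw [trace_mul_comm, ← mul_assoc, trace_mul_comm]
  simp [trace, diagonal_mul]

theorem trace_conj_diagonal_mul_conj_diagonal (P Q : Matrix ι ι ℝ) (a b : ι → ℝ) :
    (P * diagonal a * Pᵀ * (Q * diagonal b * Qᵀ)).trace =
      ∑ i, ∑ j, a i * b j * (Pᵀ * Q) i j ^ 2 := by
  have h : (P * diagonal a * Pᵀ * (Q * diagonal b * Qᵀ)).trace =
      ((diagonal a * (Pᵀ * Q)) * (diagonal b * (Pᵀ * Q)ᵀ)).trace := by
    rw [show P * diagonal a * Pᵀ * (Q * diagonal b * Qᵀ) =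
      P * (diagonal a * Pᵀ * (Q * diagonal b * Qᵀ)) by simp only [mul_assoc], trace_mul_comm]
    simp only [transpose_mul, transpose_transpose, mul_assoc]
  rw [h]
  simp only [trace, diag_apply, mul_apply (M := diagonal a * (Pᵀ * Q)), diagonal_mul,
    transpose_apply]
  refine Finset.sum_congr rfl fun i _ => Finset.sum_congr rfl fun j _ => by ring

theorem sum_sq_row_of_transpose_mul_self {M : Matrix ι ι ℝ} (h : Mᵀ * M = 1) (i : ι) :
    ∑ j, M i j ^ 2 = 1 := by
  have h' : M * Mᵀ = 1 := mul_eq_one_comm.mp h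
  have := congrFun (congrFun h' i) i
  simpa [mul_apply, sq] using this

theorem sum_sq_col_of_transpose_mul_self {M : Matrix ι ι ℝ} (h : Mᵀ * M = 1) (j : ι) :
    ∑ i, M i j ^ 2 = 1 := by
  have := congrFun (congrFun h j) j
  simpa [mul_apply, sq] using this

theorem PosDef.exists_orthogonal_diagonal {A : Matrix ι ι ℝ} (hA : A.PosDef) :
    ∃ (U : Matrix ι ι ℝ) (α : ι → ℝ), Uᵀ * U = 1 ∧ (∀ i, 0 < α i) ∧
      A = U * diagonal α * Uᵀ := by
  refine ⟨hA.isHermitian.eigenvectorUnitary, hA.isHermitian.eigenvalues, ?_, hA.eigenvalues_pos, ?_⟩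
  · have := Unitary.star_mul_self_of_mem hA.isHermitian.eigenvectorUnitary.2
    rwa [star_eq_conjTranspose, conjTranspose_eq_transpose_of_trivial] at this
  · have := hA.isHermitian.spectral_theorem
    rw [Unitary.conjStarAlgAut_apply, star_eq_conjTranspose,
      conjTranspose_eq_transpose_of_trivial] at this
    exact this

theorem isUnit_of_transpose_mul_self {U : Matrix ι ι ℝ} (h : Uᵀ * U = 1) : IsUnit U :=
  IsUnit.of_mul_eq_one _ (mul_eq_one_comm.mp h)

theorem isUnit_diagonal_of_pos {d : ι → ℝ} (hd : ∀ i, 0 < d i) : IsUnit (diagonal d) := by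
  rw [isUnit_diagonal, Pi.isUnit_iff]
  exact fun i => (hd i).ne'.isUnit

theorem PosDef.exists_eq_mul_transpose {A : Matrix ι ι ℝ} (hA : A.PosDef) :
    ∃ R : Matrix ι ι ℝ, IsUnit R ∧ A = R * Rᵀ := by
  obtain ⟨U, α, hU, hα, rfl⟩ := hA.exists_orthogonal_diagonal
  refine ⟨U * diagonal fun i => √(α i), (isUnit_of_transpose_mul_self hU).mul
    (isUnit_diagonal_of_pos fun i => Real.sqrt_pos.2 (hα i)), ?_⟩
  have : diagonal α = diagonal (fun i => √(α i)) * diagonal (fun i => √(α i)) := by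
    rw [diagonal_mul_diagonal]
    congr 1; ext i; exact (Real.mul_self_sqrt (hα i).le).symm
  rw [transpose_mul, diagonal_transpose, this]
  simp only [mul_assoc]

theorem PosDef.conj_transpose_of_isUnit {A R : Matrix ι ι ℝ} (hA : A.PosDef) (hR : IsUnit R) :
    (R * A * Rᵀ).PosDef := by
  have := (IsUnit.posDef_star_right_conjugate_iff hR).2 hA
  rwa [star_eq_conjTranspose, conjTranspose_eq_transpose_of_trivial] at this

theorem eq_conj_inv_conj {R : Matrix ι ι ℝ} (hR : IsUnit R) (A : Matrix ι ι ℝ) :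
    A = R * (R⁻¹ * A * (R⁻¹)ᵀ) * Rᵀ := by
  have h1 : R * R⁻¹ = 1 := mul_nonsing_inv _ ((isUnit_iff_isUnit_det _).1 hR)
  have h2 : (R⁻¹)ᵀ * Rᵀ = 1 := by rw [← transpose_mul, h1, transpose_one]
  calc A = (R * R⁻¹) * A * ((R⁻¹)ᵀ * Rᵀ) := by rw [h1, h2]; simp
    _ = _ := by simp only [mul_assoc]

/-- Simultaneous diagonalization by congruence. -/
theorem PosDef.exists_simultaneous_diagonal {V W : Matrix ι ι ℝ} (hV : V.PosDef) (hW : W.PosDef) :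
    ∃ (P : Matrix ι ι ℝ) (d : ι → ℝ), IsUnit P ∧ (∀ i, 0 < d i) ∧
      V = P * Pᵀ ∧ W = P * diagonal d * Pᵀ := by
  obtain ⟨R, hR, rfl⟩ := hV.exists_eq_mul_transpose
  have hRi : IsUnit R⁻¹ := (isUnit_nonsing_inv_iff).2 hR
  obtain ⟨Q, d, hQ, hd, h⟩ := (hW.conj_transpose_of_isUnit hRi).exists_orthogonal_diagonal
  refine ⟨R * Q, d, hR.mul (isUnit_of_transpose_mul_self hQ), hd, ?_, ?_⟩
  · rw [transpose_mul, mul_assoc R Q, ← mul_assoc Q, mul_eq_one_comm.mp hQ, one_mul]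
  · rw [eq_conj_inv_conj hR W, h, transpose_mul]
    simp only [mul_assoc]

theorem conj_diagonal_inv {P : Matrix ι ι ℝ} (hP : IsUnit P) {d : ι → ℝ} (hd : ∀ i, 0 < d i) :
    (P * diagonal d * Pᵀ)⁻¹ = (P⁻¹)ᵀ * diagonal (fun i => (d i)⁻¹) * ((P⁻¹)ᵀ)ᵀ := by
  have h1 : P * P⁻¹ = 1 := mul_nonsing_inv _ ((isUnit_iff_isUnit_det _).1 hP)
  have h2 : Pᵀ * (P⁻¹)ᵀ = 1 := by
    rw [← transpose_mul, nonsing_inv_mul _ ((isUnit_iff_isUnit_det _).1 hP), transpose_one]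
  have h3 : diagonal d * diagonal (fun i => (d i)⁻¹) = 1 := by
    rw [diagonal_mul_diagonal, ← diagonal_one]
    congr 1; ext i; exact mul_inv_cancel₀ (hd i).ne'
  apply inv_eq_right_inv
  rw [transpose_transpose]
  calc _ = P * diagonal d * (Pᵀ * (P⁻¹)ᵀ) * diagonal (fun i => (d i)⁻¹) * P⁻¹ := by
        simp only [mul_assoc]
    _ = P * (diagonal d * diagonal (fun i => (d i)⁻¹)) * P⁻¹ := by
        rw [h2, mul_one, mul_assoc P]
    _ = 1 := by rw [h3, mul_one, h1]

theorem charpoly_roots_conj_diagonal {P : Matrix ι ι ℝ} (hP : IsUnit P) (d : ι → ℝ) :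
    (P * diagonal d * Pᵀ * (P * Pᵀ)⁻¹).charpoly.roots = Finset.univ.val.map d := by
  have h1 : P⁻¹ * P = 1 := nonsing_inv_mul _ ((isUnit_iff_isUnit_det _).1 hP)
  have h2 : Pᵀ * (Pᵀ)⁻¹ = 1 := by
    apply mul_nonsing_inv
    rw [det_transpose]
    exact (isUnit_iff_isUnit_det _).1 hP
  have h : P * diagonal d * Pᵀ * (P * Pᵀ)⁻¹ = P * diagonal d * P⁻¹ := by
    rw [mul_inv_rev, mul_assoc _ Pᵀ, ← mul_assoc Pᵀ, h2, one_mul]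
  rw [h, charpoly_mul_comm, ← mul_assoc, h1, one_mul, charpoly_diagonal]
  have := Polynomial.roots_multiset_prod_X_sub_C (Finset.univ.val.map d)
  rwa [Multiset.map_map] at this

theorem charpoly_conj_mul_inv_conj {R : Matrix ι ι ℝ} (hR : IsUnit R) (A B : Matrix ι ι ℝ) :
    (R * A * Rᵀ * (R * B * Rᵀ)⁻¹).charpoly = (A * B⁻¹).charpoly := by
  have h1 : R⁻¹ * R = 1 := nonsing_inv_mul _ ((isUnit_iff_isUnit_det _).1 hR)
  have h2 : Rᵀ * (Rᵀ)⁻¹ = 1 := by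
    apply mul_nonsing_inv
    rw [det_transpose]
    exact (isUnit_iff_isUnit_det _).1 hR
  have h : R * A * Rᵀ * (R * B * Rᵀ)⁻¹ = R * (A * B⁻¹) * R⁻¹ := by
    calc _ = R * A * (Rᵀ * (Rᵀ)⁻¹) * B⁻¹ * R⁻¹ := by simp only [mul_inv_rev, mul_assoc]
      _ = _ := by rw [h2]; simp only [mul_assoc, one_mul]
  rw [h, charpoly_mul_comm, ← mul_assoc, h1, one_mul]

/-- If `U diag(β) Uᵀ = P diag(d) Pᵀ` with `U` orthogonal, then the squares of the entries of `UᵀP`,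
weighted by `d` and `β⁻¹`, form a doubly stochastic matrix; this is the resulting
Cauchy-Schwarz inequality. -/
theorem sum_weighted_sq_le {U P : Matrix ι ι ℝ} (hU : Uᵀ * U = 1) {β d : ι → ℝ}
    (hβ : ∀ i, 0 < β i) (hd : ∀ i, 0 < d i)
    (h : U * diagonal β * Uᵀ = P * diagonal d * Pᵀ) (x y : ι → ℝ) :
    (∑ i, ∑ j, x i / β i * (y j * d j) * (Uᵀ * P) i j ^ 2) ^ 2 ≤
      (∑ i, x i ^ 2) * ∑ j, y j ^ 2 := by
  set M : Matrix ι ι ℝ := diagonal (fun i => (√(β i))⁻¹) * (Uᵀ * P) * diagonal (fun j => √(d j))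
    with hM
  have hMM : M * Mᵀ = 1 := by
    have hdd : diagonal (fun j => √(d j)) * diagonal (fun j => √(d j)) = diagonal d := by
      rw [diagonal_mul_diagonal]
      congr 1; ext i; exact Real.mul_self_sqrt (hd i).le
    calc M * Mᵀ = diagonal (fun i => (√(β i))⁻¹) * (Uᵀ * (P * (diagonal (fun j => √(d j)) *
          diagonal (fun j => √(d j))) * Pᵀ) * U) * diagonal (fun i => (√(β i))⁻¹) := by
          simp only [hM, transpose_mul, diagonal_transpose, transpose_transpose, mul_assoc]
      _ = diagonal (fun i => (√(β i))⁻¹) * ((Uᵀ * U) * diagonal β * (Uᵀ * U)) *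
          diagonal (fun i => (√(β i))⁻¹) := by
          rw [hdd, ← h]; simp only [mul_assoc]
      _ = 1 := by
          rw [hU, one_mul, mul_one, diagonal_mul_diagonal, diagonal_mul_diagonal, ← diagonal_one]
          congr 1; ext i
          have := Real.sqrt_pos.2 (hβ i)
          field_simp
          exact (Real.sq_sqrt (hβ i).le).symm
  have hMM' := mul_eq_one_comm.mp hMM
  have hentry : ∀ i j, M i j ^ 2 = d j / β i * (Uᵀ * P) i j ^ 2 := by
    intro i j
    rw [hM, mul_diagonal, diagonal_mul, mul_pow, mul_pow, inv_pow, Real.sq_sqrt (hβ i).le,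
      Real.sq_sqrt (hd j).le]
    ring
  have e1 : ∑ i, ∑ j, x i / β i * (y j * d j) * (Uᵀ * P) i j ^ 2 =
      ∑ p : ι × ι, (x p.1 * M p.1 p.2) * (y p.2 * M p.1 p.2) := by
    rw [Fintype.sum_prod_type]
    refine Finset.sum_congr rfl fun i _ => Finset.sum_congr rfl fun j _ => ?_
    rw [show x i * M i j * (y j * M i j) = x i * y j * M i j ^ 2 by ring, hentry]
    ring
  have e2 : ∑ i, x i ^ 2 = ∑ p : ι × ι, (x p.1 * M p.1 p.2) ^ 2 := by
    rw [Fintype.sum_prod_type]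
    refine Finset.sum_congr rfl fun i _ => ?_
    simp only [mul_pow]
    rw [← Finset.mul_sum, sum_sq_row_of_transpose_mul_self hMM', mul_one]
  have e3 : ∑ j, y j ^ 2 = ∑ p : ι × ι, (y p.2 * M p.1 p.2) ^ 2 := by
    rw [Fintype.sum_prod_type, Finset.sum_comm]
    refine Finset.sum_congr rfl fun j _ => ?_
    simp only [mul_pow]
    rw [← Finset.mul_sum, sum_sq_col_of_transpose_mul_self hMM', mul_one]
  rw [e1, e2, e3]
  exact Finset.sum_mul_sq_le_sq_mul_sq _ _ _

/-- A scalar second-order bound for `g` on the eigenvalues of two symmetric matrices passes to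
the trace function `A ↦ tr g(A)`. -/
theorem abs_sum_sub_sum_sub_trace_le {U V : Matrix ι ι ℝ} (hU : Uᵀ * U = 1) (hV : Vᵀ * V = 1)
    (α β : ι → ℝ) (g g' : ℝ → ℝ) (C : ℝ)
    (hg : ∀ i j, |g (α i) - g (β j) - g' (β j) * (α i - β j)| ≤ C * (α i - β j) ^ 2) :
    |∑ i, g (α i) - ∑ j, g (β j) - (V * diagonal (fun j => g' (β j)) * Vᵀ *
      (U * diagonal α * Uᵀ - V * diagonal β * Vᵀ)).trace| ≤
      C * ((U * diagonal α * Uᵀ - V * diagonal β * Vᵀ) *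
        (U * diagonal α * Uᵀ - V * diagonal β * Vᵀ)).trace := by
  set M := Uᵀ * V with hM
  have hMM : Mᵀ * M = 1 := by
    calc Mᵀ * M = Vᵀ * (U * Uᵀ) * V := by
          simp only [hM, transpose_mul, transpose_transpose, mul_assoc]
      _ = 1 := by rw [mul_eq_one_comm.mp hU, mul_one, hV]
  have hrow := sum_sq_row_of_transpose_mul_self hMM
  have hcol := sum_sq_col_of_transpose_mul_self hMM
  have row : ∀ f : ι → ℝ, ∑ i, f i = ∑ i, ∑ j, f i * M i j ^ 2 := fun f =>
    Finset.sum_congr rfl fun i _ => by rw [← Finset.mul_sum, hrow, mul_one]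
  have col : ∀ f : ι → ℝ, ∑ j, f j = ∑ i, ∑ j, f j * M i j ^ 2 := fun f => by
    rw [Finset.sum_comm]
    exact Finset.sum_congr rfl fun i _ => by rw [← Finset.mul_sum, hcol, mul_one]
  have self : ∀ {Q : Matrix ι ι ℝ} (_ : Qᵀ * Q = 1) (a b : ι → ℝ),
      (Q * diagonal a * Qᵀ * (Q * diagonal b * Qᵀ)).trace = ∑ i, a i * b i := by
    intro Q hQ a b
    rw [trace_conj_diagonal_mul_conj_diagonal, hQ]
    simp [one_apply]
  have e1 : (V * diagonal (fun j => g' (β j)) * Vᵀ *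
      (U * diagonal α * Uᵀ - V * diagonal β * Vᵀ)).trace =
      ∑ i, ∑ j, g' (β j) * (α i - β j) * M i j ^ 2 := by
    rw [mul_sub, trace_sub, trace_mul_comm, trace_conj_diagonal_mul_conj_diagonal, self hV,
      col fun j => g' (β j) * β j]
    simp only [← Finset.sum_sub_distrib, ← hM]
    exact Finset.sum_congr rfl fun i _ => Finset.sum_congr rfl fun j _ => by ring
  have e2 : ((U * diagonal α * Uᵀ - V * diagonal β * Vᵀ) *
        (U * diagonal α * Uᵀ - V * diagonal β * Vᵀ)).trace =
      ∑ i, ∑ j, (α i - β j) ^ 2 * M i j ^ 2 := by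
    rw [sub_mul, mul_sub, mul_sub, trace_sub, trace_sub, trace_sub, self hU, self hV,
      trace_mul_comm (V * diagonal β * Vᵀ), trace_conj_diagonal_mul_conj_diagonal,
      col fun j => β j * β j, row fun i => α i * α i]
    simp only [← Finset.sum_sub_distrib, ← hM]
    exact Finset.sum_congr rfl fun i _ => Finset.sum_congr rfl fun j _ => by ring
  rw [e1, e2, row, col fun j => g (β j), Finset.mul_sum]
  simp only [← Finset.sum_sub_distrib]
  refine (Finset.abs_sum_le_sum_abs _ _).trans (Finset.sum_le_sum fun i _ => ?_)
  rw [Finset.mul_sum]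
  refine (Finset.abs_sum_le_sum_abs _ _).trans (Finset.sum_le_sum fun j _ => ?_)
  rw [← sub_mul, ← sub_mul, abs_mul, abs_of_nonneg (sq_nonneg (M i j)), ← mul_assoc]
  exact mul_le_mul_of_nonneg_right (hg i j) (sq_nonneg _)

end Matrix

theorem Real.abs_log_sq_sub_log_sq_sub_le {x y c : ℝ} (hx : 0 < x) (hy : 0 < y)
    (hxc : x⁻¹ ≤ c) (hyc : y⁻¹ ≤ c) (hlc : |Real.log y| ≤ c) :
    |Real.log x ^ 2 - Real.log y ^ 2 - 2 * Real.log y / y * (x - y)| ≤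
      (2 * c ^ 2 + 2 * c ^ 3) * (x - y) ^ 2 := by
  have hc : 0 ≤ c := (abs_nonneg _).trans hlc
  set r := x / y with hr
  have hr0 : 0 < r := div_pos hx hy
  set u := Real.log r with hu
  have hux : Real.log x = Real.log y + u := by
    rw [hu, hr, Real.log_div hx.ne' hy.ne']; ring
  have hu1 : u ≤ r - 1 := Real.log_le_sub_one_of_pos hr0
  have hu2 : 1 - r⁻¹ ≤ u := Real.one_sub_inv_le_log_of_pos hr0
  have h1 : (r - 1) ^ 2 ≤ c ^ 2 * (x - y) ^ 2 := by
    have : r - 1 = y⁻¹ * (x - y) := by rw [hr]; field_simp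
    rw [this, mul_pow]
    have : 0 < y⁻¹ := inv_pos.2 hy
    gcongr
  have h2 : (1 - r⁻¹) ^ 2 ≤ c ^ 2 * (x - y) ^ 2 := by
    have : 1 - r⁻¹ = x⁻¹ * (x - y) := by rw [hr]; field_simp
    rw [this, mul_pow]
    have : 0 < x⁻¹ := inv_pos.2 hx
    gcongr
  have h3 : (r - 1) - (1 - r⁻¹) ≤ c ^ 2 * (x - y) ^ 2 := by
    have : (r - 1) - (1 - r⁻¹) = x⁻¹ * y⁻¹ * (x - y) ^ 2 := by rw [hr]; field_simp
    rw [this, sq c]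
    have : 0 < x⁻¹ := inv_pos.2 hx
    have : 0 < y⁻¹ := inv_pos.2 hy
    gcongr
  have h4 : u ^ 2 ≤ 2 * c ^ 2 * (x - y) ^ 2 := by
    rcases le_total 0 u with h | h
    · nlinarith [mul_self_le_mul_self h hu1, sq_nonneg (1 - r⁻¹)]
    · nlinarith [mul_self_le_mul_self (neg_nonneg.2 h) (neg_le_neg hu2), sq_nonneg (r - 1)]
  have h5 : |Real.log y * (u - (r - 1))| ≤ c ^ 3 * (x - y) ^ 2 := by
    have : |u - (r - 1)| ≤ c ^ 2 * (x - y) ^ 2 := by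
      rw [abs_le]; constructor <;> nlinarith
    rw [abs_mul, pow_succ' c 2, mul_assoc]
    exact mul_le_mul hlc this (abs_nonneg _) hc
  have e : Real.log x ^ 2 - Real.log y ^ 2 - 2 * Real.log y / y * (x - y) =
      u ^ 2 + 2 * (Real.log y * (u - (r - 1))) := by
    rw [hux, hr]; field_simp; ring
  rw [e]
  calc |u ^ 2 + 2 * (Real.log y * (u - (r - 1)))|
      ≤ |u ^ 2| + 2 * |Real.log y * (u - (r - 1))| := by
        refine (abs_add_le _ _).trans ?_
        rw [abs_mul 2, abs_two]
    _ ≤ _ := by rw [abs_of_nonneg (sq_nonneg u)]; linarith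

theorem sqrt_le_sqrt_add_of_abs_deriv_le {F F' : ℝ → ℝ} {c : ℝ} (hF : ∀ t, 0 ≤ F t)
    (hd : ∀ t, HasDerivAt F (F' t) t) (hF' : ∀ t, |F' t| ≤ 2 * √(F t) * c) (hc : 0 ≤ c) :
    √(F 1) ≤ √(F 0) + c := by
  have key : ∀ ε > 0, √(F 1 + ε) ≤ √(F 0 + ε) + c := by
    intro ε hε
    have hpos : ∀ t, 0 < F t + ε := fun t => by linarith [hF t]
    have hd' : ∀ t, HasDerivAt (fun s => √(F s + ε)) (F' t / (2 * √(F t + ε))) t := fun t =>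
      ((hd t).add_const ε).sqrt (hpos t).ne'
    have := Convex.norm_image_sub_le_of_norm_hasDerivWithin_le (C := c) (x := 0) (y := 1)
      (fun t _ => (hd' t).hasDerivWithinAt (s := Set.univ))
      (fun t _ => by
        have h0 := Real.sqrt_pos.2 (hpos t)
        rw [Real.norm_eq_abs, abs_div, abs_of_pos (by positivity : 0 < 2 * √(F t + ε)),
          div_le_iff₀ (by positivity)]
        have : √(F t) ≤ √(F t + ε) := Real.sqrt_le_sqrt (by linarith)
        nlinarith [hF' t, mul_le_mul_of_nonneg_right this hc]) convex_univ
      (Set.mem_univ _) (Set.mem_univ _)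
    rw [Real.norm_eq_abs] at this
    have := (le_abs_self _).trans this
    norm_num at this
    linarith
  have lim : ∀ a : ℝ, Filter.Tendsto (fun ε => √(a + ε)) (nhdsWithin 0 (Set.Ioi 0))
      (nhds √a) := by
    intro a
    have : Continuous fun ε => √(a + ε) := by fun_prop
    simpa using (this.tendsto 0).mono_left nhdsWithin_le_nhds
  exact le_of_tendsto_of_tendsto (lim (F 1)) ((lim (F 0)).add_const c)
    (Filter.eventually_of_mem self_mem_nhdsWithin key)

theorem hasDerivAt_of_abs_sub_sub_le {F L R : ℝ → ℝ} {L' t C : ℝ} (hL : HasDerivAt L L' t)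
    (hLt : L t = 0) (hR : HasDerivAt R 0 t) (hRt : R t = 0)
    (h : ∀ᶠ s in nhds t, |F s - F t - L s| ≤ C * R s) : HasDerivAt F L' t := by
  rw [hasDerivAt_iff_isLittleO] at *
  have hR' : R =o[nhds t] fun s => s - t := by simpa [hRt] using hR
  have h1 : (fun s => F s - F t - L s) =o[nhds t] fun s => s - t := by
    refine Asymptotics.IsBigO.trans_isLittleO (Asymptotics.IsBigO.of_bound |C| ?_) hR'
    filter_upwards [h] with s hs
    rw [Real.norm_eq_abs, Real.norm_eq_abs, ← abs_mul]
    exact hs.trans (le_abs_self _)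
  refine (h1.add hL).congr_left fun s => ?_
  rw [hLt]; ring

section

open Matrix

variable {ι : Type*} [Fintype ι] [DecidableEq ι]

/-- The derivative of `tr (log A(s))²` along the curve `A(s) = P exp(s diag k) Pᵀ`. -/
theorem hasDerivAt_sum_log_sq {P : Matrix ι ι ℝ} (hP : IsUnit P) (k : ι → ℝ)
    {U : ℝ → Matrix ι ι ℝ} {α : ℝ → ι → ℝ} (hU : ∀ s, (U s)ᵀ * U s = 1)
    (hα : ∀ s i, 0 < α s i)
    (hA : ∀ s, U s * diagonal (α s) * (U s)ᵀ = P * diagonal (fun j => Real.exp (s * k j)) * Pᵀ)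
    (t : ℝ) :
    HasDerivAt (fun s => ∑ i, Real.log (α s i) ^ 2)
      (∑ i, ∑ j, 2 * Real.log (α t i) / α t i * (k j * Real.exp (t * k j)) *
        ((U t)ᵀ * P) i j ^ 2) t := by
  have hexp : ∀ j, HasDerivAt (fun s => Real.exp (s * k j) - Real.exp (t * k j))
      (k j * Real.exp (t * k j)) t := fun j => by
    simpa [mul_comm] using ((hasDerivAt_mul_const (x := t) (k j)).exp).sub_const
      (Real.exp (t * k j))
  have hsub : ∀ s, U s * diagonal (α s) * (U s)ᵀ - U t * diagonal (α t) * (U t)ᵀ =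
      P * diagonal (fun j => Real.exp (s * k j) - Real.exp (t * k j)) * Pᵀ := fun s => by
    rw [hA, hA, ← sub_mul, ← mul_sub, diagonal_sub]
  have htr : ∀ s, ∑ i, (α s i)⁻¹ =
      ∑ j, (Real.exp (s * k j))⁻¹ * (((P⁻¹)ᵀ)ᵀ * (P⁻¹)ᵀ) j j := fun s => by
    have h := congrArg (fun X => trace X⁻¹) (hA s)
    simp only [conj_diagonal_inv hP fun j => Real.exp_pos (s * k j),
      conj_diagonal_inv (isUnit_of_transpose_mul_self (hU s)) (hα s), trace_conj_diagonal] at h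
    rw [← h, inv_eq_left_inv (hU s)]
    simp [hU s]
  obtain ⟨c, hc⟩ : ∃ c : ℝ, (∑ i, (α t i)⁻¹ + 1 ≤ c) ∧ ∀ i, |Real.log (α t i)| ≤ c := by
    refine ⟨max (∑ i, (α t i)⁻¹ + 1) (∑ i, |Real.log (α t i)|), le_max_left _ _, fun i => ?_⟩
    exact (Finset.single_le_sum (f := fun i => |Real.log (α t i)|) (fun i _ => abs_nonneg _)
      (Finset.mem_univ i)).trans (le_max_right _ _)
  have hsingle : ∀ s i, (α s i)⁻¹ ≤ ∑ i, (α s i)⁻¹ := fun s i =>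
    Finset.single_le_sum (f := fun i => (α s i)⁻¹) (fun i _ => (inv_pos.2 (hα s i)).le)
      (Finset.mem_univ i)
  have hev : ∀ᶠ s in nhds t, ∑ i, (α s i)⁻¹ < ∑ i, (α t i)⁻¹ + 1 := by
    have hcont : Continuous fun s => ∑ i, (α s i)⁻¹ := by
      simp only [htr]
      refine continuous_finsetSum _ fun j _ => ?_
      simp only [← Real.exp_neg]
      fun_prop
    exact hcont.continuousAt.eventually_lt continuousAt_const (by simp)
  refine hasDerivAt_of_abs_sub_sub_le (C := 2 * c ^ 2 + 2 * c ^ 3)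
    (L := fun s => ∑ i, ∑ j, 2 * Real.log (α t i) / α t i *
      (Real.exp (s * k j) - Real.exp (t * k j)) * ((U t)ᵀ * P) i j ^ 2)
    (R := fun s => ∑ i, ∑ j, (Real.exp (s * k i) - Real.exp (t * k i)) *
      (Real.exp (s * k j) - Real.exp (t * k j)) * (Pᵀ * P) i j ^ 2) ?_ (by simp) ?_ (by simp) ?_
  · refine HasDerivAt.fun_sum fun i _ => HasDerivAt.fun_sum fun j _ => ?_
    exact ((hexp j).const_mul _).mul_const _
  · have : HasDerivAt (fun s => ∑ i, ∑ j, (Real.exp (s * k i) - Real.exp (t * k i)) *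
      (Real.exp (s * k j) - Real.exp (t * k j)) * (Pᵀ * P) i j ^ 2)
      (∑ i : ι, ∑ j : ι, (0 : ℝ)) t := by
      refine HasDerivAt.fun_sum fun i _ => HasDerivAt.fun_sum fun j _ => ?_
      simpa using ((hexp i).mul (hexp j)).mul_const ((Pᵀ * P) i j ^ 2)
    simpa using this
  · filter_upwards [hev] with s hs
    have := abs_sum_sub_sum_sub_trace_le (hU s) (hU t) (α s) (α t) (fun x => Real.log x ^ 2)
      (fun x => 2 * Real.log x / x) (2 * c ^ 2 + 2 * c ^ 3) fun i j =>
        Real.abs_log_sq_sub_log_sq_sub_le (hα s i) (hα t j)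
          ((hsingle s i).trans (hs.le.trans hc.1))
          ((hsingle t j).trans (by linarith [hc.1])) (hc.2 j)
    rwa [hsub, trace_conj_diagonal_mul_conj_diagonal,
      trace_conj_diagonal_mul_conj_diagonal] at this

end

section

variable {n : ℕ}

theorem riemannianDist_conj_diagonal {P : Matrix (Fin n) (Fin n) ℝ} (hP : IsUnit P)
    (d : Fin n → ℝ) :
    riemannianDist (P * diagonal d * Pᵀ) (P * Pᵀ) = √(∑ i, Real.log (d i) ^ 2) := by
  rw [riemannianDist, charpoly_roots_conj_diagonal hP, Multiset.map_map]
  rfl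

theorem riemannianDist_conj {R : Matrix (Fin n) (Fin n) ℝ} (hR : IsUnit R)
    (A B : Matrix (Fin n) (Fin n) ℝ) :
    riemannianDist (R * A * Rᵀ) (R * B * Rᵀ) = riemannianDist A B := by
  rw [riemannianDist, charpoly_conj_mul_inv_conj hR, riemannianDist]

theorem riemannianDist_comm {U V : Matrix (Fin n) (Fin n) ℝ} (hU : U.PosDef) (hV : V.PosDef) :
    riemannianDist U V = riemannianDist V U := by
  obtain ⟨P, d, hP, hd, rfl, rfl⟩ := hV.exists_simultaneous_diagonal hU
  set S : Matrix (Fin n) (Fin n) ℝ := diagonal fun i => √(d i) with hS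
  have hSS : S * S = diagonal d := by
    rw [hS, diagonal_mul_diagonal]
    congr 1; ext i; exact Real.mul_self_sqrt (hd i).le
  have hPS : IsUnit (P * S) :=
    hP.mul (isUnit_diagonal_of_pos fun i => Real.sqrt_pos.2 (hd i))
  have hST : Sᵀ = S := diagonal_transpose _
  have e1 : P * diagonal d * Pᵀ = P * S * (P * S)ᵀ := by
    rw [transpose_mul, hST, ← hSS]; simp only [mul_assoc]
  have hSdS : S * diagonal (fun i => (d i)⁻¹) * S = 1 := by
    rw [hS, diagonal_mul_diagonal, diagonal_mul_diagonal, ← diagonal_one]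
    congr 1; ext i
    rw [mul_right_comm, Real.mul_self_sqrt (hd i).le, mul_inv_cancel₀ (hd i).ne']
  have e2 : P * Pᵀ = P * S * diagonal (fun i => (d i)⁻¹) * (P * S)ᵀ := by
    calc P * Pᵀ = P * (S * diagonal (fun i => (d i)⁻¹) * S) * Pᵀ := by rw [hSdS, mul_one]
      _ = _ := by rw [transpose_mul, hST]; simp only [mul_assoc]
  rw [riemannianDist_conj_diagonal hP, e1, e2, riemannianDist_conj_diagonal hPS]
  simp

theorem riemannianDist_one_le {V W : Matrix (Fin n) (Fin n) ℝ} (hV : V.PosDef) (hW : W.PosDef) :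
    riemannianDist W 1 ≤ riemannianDist V 1 + riemannianDist W V := by
  obtain ⟨P, d, hP, hd, rfl, rfl⟩ := hV.exists_simultaneous_diagonal hW
  set k : Fin n → ℝ := fun i => Real.log (d i) with hk
  have hpos : ∀ s : ℝ, (P * diagonal (fun j => Real.exp (s * k j)) * Pᵀ).PosDef := fun s =>
    (PosDef.diagonal fun j => Real.exp_pos _).conj_transpose_of_isUnit hP
  choose U α hU hα hA using fun s => (hpos s).exists_orthogonal_diagonal
  have hdist : ∀ s, riemannianDist (P * diagonal (fun j => Real.exp (s * k j)) * Pᵀ) 1 =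
      √(∑ i, Real.log (α s i) ^ 2) := fun s => by
    rw [hA s, ← riemannianDist_conj_diagonal (isUnit_of_transpose_mul_self (hU s)),
      mul_eq_one_comm.mp (hU s)]
  have h0 : diagonal (fun j => Real.exp (0 * k j)) = (1 : Matrix (Fin n) (Fin n) ℝ) := by simp
  have h1 : diagonal (fun j => Real.exp (1 * k j)) = diagonal d := by
    congr 1; ext j; rw [one_mul, hk, Real.exp_log (hd j)]
  have key := sqrt_le_sqrt_add_of_abs_deriv_le (c := √(∑ i, k i ^ 2))
    (fun s => Finset.sum_nonneg fun i _ => sq_nonneg (Real.log (α s i)))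
    (hasDerivAt_sum_log_sq hP k hU hα fun s => (hA s).symm)
    (fun t => by
      have := sum_weighted_sq_le (hU t) (hα t) (fun j => Real.exp_pos (t * k j)) (hA t).symm
        (fun i => 2 * Real.log (α t i)) k
      refine (Real.abs_le_sqrt this).trans_eq ?_
      simp only [mul_pow]
      rw [← Finset.mul_sum, Real.sqrt_mul (by positivity), Real.sqrt_mul (by positivity),
        Real.sqrt_sq (by norm_num)])
    (Real.sqrt_nonneg _)
  rw [← hdist, ← hdist, h0, h1, mul_one] at key
  rwa [riemannianDist_conj_diagonal hP d]

theorem riemannianDist_triangle {U V W : Matrix (Fin n) (Fin n) ℝ} (hU : U.PosDef)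
    (hV : V.PosDef) (hW : W.PosDef) :
    riemannianDist W U ≤ riemannianDist V U + riemannianDist W V := by
  obtain ⟨R, hR, rfl⟩ := hU.exists_eq_mul_transpose
  have hRi : IsUnit R⁻¹ := (isUnit_nonsing_inv_iff).2 hR
  have := riemannianDist_one_le (hV.conj_transpose_of_isUnit hRi) (hW.conj_transpose_of_isUnit hRi)
  rw [← riemannianDist_conj hR _ 1, ← riemannianDist_conj hR _ 1, ← riemannianDist_conj hR _
    (R⁻¹ * V * R⁻¹ᵀ), ← eq_conj_inv_conj hR, ← eq_conj_inv_conj hR, mul_one] at this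
  exact this

theorem riemannianDist_eq_zero_iff {U V : Matrix (Fin n) (Fin n) ℝ} (hU : U.PosDef)
    (hV : V.PosDef) : riemannianDist U V = 0 ↔ U = V := by
  obtain ⟨P, d, hP, hd, rfl, rfl⟩ := hV.exists_simultaneous_diagonal hU
  constructor
  · intro h
    rw [riemannianDist_conj_diagonal hP,
      Real.sqrt_eq_zero (Finset.sum_nonneg fun i _ => sq_nonneg _),
      Finset.sum_eq_zero_iff_of_nonneg fun i _ => sq_nonneg _] at h
    have : d = fun _ => 1 := by
      ext i
      exact Real.eq_one_of_pos_of_log_eq_zero (hd i) (pow_eq_zero_iff two_ne_zero |>.1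
        (h i (Finset.mem_univ i)))
    rw [this, diagonal_one, mul_one]
  · intro h
    have h1 := riemannianDist_conj_diagonal hP fun _ => 1
    rw [h]
    simpa using h1

end

/-- For symmetric positive definite `U, V`, all eigenvalues of `U V⁻¹` are
real and positive (the characteristic polynomial has `n` real roots, all positive), and
`δ` is a metric on the symmetric positive definite matrices. -/
theorem riemannianDist_is_metric {n : ℕ} :
    (∀ U V : Matrix (Fin n) (Fin n) ℝ, U.PosDef → V.PosDef →
      (U * V⁻¹).charpoly.roots.card = n ∧ ∀ μ ∈ (U * V⁻¹).charpoly.roots, 0 < μ) ∧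
    (∀ U V : Matrix (Fin n) (Fin n) ℝ, U.PosDef → V.PosDef →
      0 ≤ riemannianDist U V) ∧
    (∀ U V : Matrix (Fin n) (Fin n) ℝ, U.PosDef → V.PosDef →
      (riemannianDist U V = 0 ↔ U = V)) ∧
    (∀ U V : Matrix (Fin n) (Fin n) ℝ, U.PosDef → V.PosDef →
      riemannianDist U V = riemannianDist V U) ∧
    (∀ U V W : Matrix (Fin n) (Fin n) ℝ, U.PosDef → V.PosDef → W.PosDef →
      riemannianDist U W ≤ riemannianDist U V + riemannianDist V W) := by
  refine ⟨fun U V hU hV => ?_, fun U V _ _ => Real.sqrt_nonneg _,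
    fun U V hU hV => riemannianDist_eq_zero_iff hU hV, fun U V hU hV => riemannianDist_comm hU hV,
    fun U V W hU hV hW => ?_⟩
  · obtain ⟨P, d, hP, hd, rfl, rfl⟩ := hV.exists_simultaneous_diagonal hU
    rw [charpoly_roots_conj_diagonal hP]
    refine ⟨by simp, fun μ hμ => ?_⟩
    obtain ⟨i, -, rfl⟩ := Multiset.mem_map.1 hμ
    exact hd i
  · have := riemannianDist_triangle hU hV hW
    rwa [riemannianDist_comm hW hU, riemannianDist_comm hV hU, riemannianDist_comm hW hV] at this
end

section
/- Let A be an invertible n×n real matrix, B an n×m real matrix, Q an n×n real symmetric positive semidefinite matrix, and R an m×m real symmetric positive definite matrix. Then the Riccati operator R is nonexpansive with respect to the Riemannian distance on symmetric positive definite matrices: for all n×n symmetric positive definite matrices X and Y, δ(R(X), R(Y)) ≤ δ(X, Y). -/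
open Matrix

/-- The Riccati operator `R(P) = Q + Aᵀ(P − P B (R + Bᵀ P B)⁻¹ Bᵀ P) A`. -/
noncomputable def ricOp {n m : ℕ} (A Q : Matrix (Fin n) (Fin n) ℝ)
    (B : Matrix (Fin n) (Fin m) ℝ) (R : Matrix (Fin m) (Fin m) ℝ)
    (P : Matrix (Fin n) (Fin n) ℝ) : Matrix (Fin n) (Fin n) ℝ :=
  Q + Aᵀ * (P - P * B * (R + Bᵀ * P * B)⁻¹ * Bᵀ * P) * A

/-- Orthogonal diagonalization of a real symmetric matrix. -/
theorem exists_orthogonal_diagonalization {n : ℕ} {M : Matrix (Fin n) (Fin n) ℝ}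
    (hM : M.IsHermitian) :
    ∃ U : Matrix (Fin n) (Fin n) ℝ, Uᵀ * U = 1 ∧ Uᵀ * M * U = diagonal hM.eigenvalues := by
  refine ⟨hM.eigenvectorUnitary, ?_, ?_⟩
  · have h := Unitary.coe_star_mul_self hM.eigenvectorUnitary
    rwa [star_eq_conjTranspose, conjTranspose_eq_transpose_of_trivial] at h
  · have h := hM.conjStarAlgAut_star_eigenvectorUnitary
    rw [Unitary.conjStarAlgAut_star_apply, star_eq_conjTranspose,
      conjTranspose_eq_transpose_of_trivial] at h
    simpa [Function.comp_def] using h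

/-- Simultaneous diagonalization by congruence, with sorted diagonal. -/
theorem exists_simultaneous_diagonalization {n : ℕ} {X Y : Matrix (Fin n) (Fin n) ℝ}
    (hX : X.PosDef) (hY : Y.PosDef) :
    ∃ (P : Matrix (Fin n) (Fin n) ℝ) (d : Fin n → ℝ), Monotone d ∧ (∀ i, 0 < d i) ∧
      Pᵀ * Y * P = 1 ∧ Pᵀ * X * P = diagonal d := by
  obtain ⟨V, -, hVY⟩ := exists_orthogonal_diagonalization hY.1
  set S : Matrix (Fin n) (Fin n) ℝ := diagonal fun i => (√(hY.1.eigenvalues i))⁻¹ with hS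
  have hCY : (V * S)ᵀ * Y * (V * S) = 1 := by
    calc (V * S)ᵀ * Y * (V * S) = S * (Vᵀ * Y * V) * S := by
          simp [hS, Matrix.mul_assoc]
      _ = 1 := by
          rw [hVY, hS, diagonal_mul_diagonal, diagonal_mul_diagonal, ← diagonal_one]
          congr 1
          ext i
          have h := hY.eigenvalues_pos i
          have h' := Real.mul_self_sqrt h.le
          have h'' := (Real.sqrt_pos.2 h).ne'
          field_simp
          nlinarith
  set C := V * S
  have hM : (Cᵀ * X * C).IsHermitian := by
    simpa using isHermitian_conjTranspose_mul_mul C hX.1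
  obtain ⟨U, hU, hUM⟩ := exists_orthogonal_diagonalization hM
  set σ := Tuple.sort hM.eigenvalues
  have hPY : ((C * U).submatrix id σ)ᵀ * Y * (C * U).submatrix id σ = 1 := by
    have h : ((C * U).submatrix id σ)ᵀ * Y * (C * U).submatrix id σ =
        ((C * U)ᵀ * Y * (C * U)).submatrix σ σ := rfl
    have h' : (C * U)ᵀ * Y * (C * U) = Uᵀ * (Cᵀ * Y * C) * U := by
      simp [Matrix.mul_assoc]
    rw [h, h', hCY, Matrix.mul_one, hU, submatrix_one_equiv]
  have hPX : ((C * U).submatrix id σ)ᵀ * X * (C * U).submatrix id σ =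
      diagonal (hM.eigenvalues ∘ σ) := by
    have h : ((C * U).submatrix id σ)ᵀ * X * (C * U).submatrix id σ =
        ((C * U)ᵀ * X * (C * U)).submatrix σ σ := rfl
    have h' : (C * U)ᵀ * X * (C * U) = Uᵀ * (Cᵀ * X * C) * U := by
      simp [Matrix.mul_assoc]
    rw [h, h', hUM, submatrix_diagonal_equiv]
  refine ⟨_, _, Tuple.monotone_sort _, ?_, hPY, hPX⟩
  rw [← posDef_diagonal_iff, ← hPX, ← conjTranspose_eq_transpose_of_trivial]
  exact hX.conjTranspose_mul_mul_same
    (mulVec_injective_iff_isUnit.2 (IsUnit.of_mul_eq_one_right _ hPY))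

theorem riemannianDist_eq_of_diagonalization {n : ℕ} {X Y P : Matrix (Fin n) (Fin n) ℝ}
    {d : Fin n → ℝ} (hPY : Pᵀ * Y * P = 1) (hPX : Pᵀ * X * P = diagonal d) :
    riemannianDist X Y = √(∑ i, Real.log (d i) ^ 2) := by
  have hinv : Y⁻¹ = P * Pᵀ := inv_eq_left_inv <| by
    rw [Matrix.mul_assoc]
    exact mul_eq_one_comm.1 hPY
  have hchar : (X * Y⁻¹).charpoly = ∏ i, (Polynomial.X - Polynomial.C (d i)) := by
    rw [hinv, ← Matrix.mul_assoc, charpoly_mul_comm, ← Matrix.mul_assoc, hPX, charpoly_diagonal]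
  have hroots : (∏ i, (Polynomial.X - Polynomial.C (d i))).roots = Finset.univ.val.map d := by
    simpa [Finset.prod, Multiset.map_map, Function.comp_def] using
      Polynomial.roots_multiset_prod_X_sub_C (Finset.univ.val.map d)
  rw [riemannianDist, hchar, hroots, Multiset.map_map]
  rfl

theorem riemannianDist_inv {n : ℕ} {X Y : Matrix (Fin n) (Fin n) ℝ}
    (hX : X.PosDef) (hY : Y.PosDef) : riemannianDist X⁻¹ Y⁻¹ = riemannianDist X Y := by
  obtain ⟨P, d, -, hd, hPY, hPX⟩ := exists_simultaneous_diagonalization hX hY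
  have hYt : Yᵀ = Y := hY.1
  have hYd : IsUnit Y.det := (isUnit_iff_isUnit_det _).1 hY.isUnit
  have hP : P⁻¹ = Pᵀ * Y := inv_eq_left_inv hPY
  have hPt : Pᵀ⁻¹ = Y * P := by rw [← transpose_nonsing_inv, hP]; simp [hYt]
  have h1 : (Y * P)ᵀ * Y⁻¹ * (Y * P) = 1 := by
    rw [transpose_mul, hYt, mul_nonsing_inv_cancel_right _ _ hYd, ← Matrix.mul_assoc, hPY]
  have h2 : (Y * P)ᵀ * X⁻¹ * (Y * P) = diagonal fun i => (d i)⁻¹ := by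
    have h := congrArg (·⁻¹) hPX
    simp only [Matrix.mul_inv_rev, hP, hPt] at h
    rw [transpose_mul, hYt, Matrix.mul_assoc, h]
    refine inv_eq_left_inv ?_
    rw [diagonal_mul_diagonal, ← diagonal_one]
    congr 1
    ext i
    exact inv_mul_cancel₀ (hd i).ne'
  rw [riemannianDist_eq_of_diagonalization h1 h2, riemannianDist_eq_of_diagonalization hPY hPX]
  simp

theorem riemannianDist_congr {n : ℕ} {A : Matrix (Fin n) (Fin n) ℝ} (hA : IsUnit A.det)
    (X Y : Matrix (Fin n) (Fin n) ℝ) :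
    riemannianDist (Aᵀ * X * A) (Aᵀ * Y * A) = riemannianDist X Y := by
  have h : Aᵀ * X * A * (Aᵀ * Y * A)⁻¹ = Aᵀ * (X * Y⁻¹ * Aᵀ⁻¹) := by
    simp only [Matrix.mul_inv_rev, Matrix.mul_assoc]
    rw [mul_nonsing_inv_cancel_left _ _ hA]
  have hAt : IsUnit Aᵀ.det := by rwa [det_transpose]
  rw [riemannianDist, riemannianDist, h, charpoly_mul_comm, nonsing_inv_mul_cancel_right _ _ hAt]

theorem dotProduct_mulVec_congr {n : ℕ} {M P : Matrix (Fin n) (Fin n) ℝ} {d : Fin n → ℝ}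
    (hP : Pᵀ * M * P = diagonal d) (a : Fin n → ℝ) :
    (P *ᵥ a) ⬝ᵥ M *ᵥ (P *ᵥ a) = ∑ j, d j * a j ^ 2 := by
  have h : (P *ᵥ a) ⬝ᵥ M *ᵥ (P *ᵥ a) = a ⬝ᵥ (Pᵀ * M * P) *ᵥ a := by
    rw [← mulVec_mulVec, ← mulVec_mulVec, dotProduct_mulVec a, vecMul_transpose]
  rw [h, hP]
  simp only [dotProduct, mulVec_diagonal]
  exact Finset.sum_congr rfl fun j _ => by ring

/-- A common test vector for the `i`-th generalized eigenvalues of two pencils, as in the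
Courant–Fischer principle. -/
theorem exists_common_test_vector {n : ℕ} {X Y X' Y' P P' : Matrix (Fin n) (Fin n) ℝ}
    {d d' : Fin n → ℝ} (hd : Monotone d) (hd' : Monotone d')
    (hPY : Pᵀ * Y * P = 1) (hPX : Pᵀ * X * P = diagonal d)
    (hPY' : P'ᵀ * Y' * P' = 1) (hPX' : P'ᵀ * X' * P' = diagonal d') (i : Fin n) :
    ∃ x ≠ 0, x ⬝ᵥ X *ᵥ x ≤ d i * (x ⬝ᵥ Y *ᵥ x) ∧ d' i * (x ⬝ᵥ Y' *ᵥ x) ≤ x ⬝ᵥ X' *ᵥ x := by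
  let K : Matrix (Fin n) (Fin n) ℝ := fun j =>
    if i < j then P⁻¹ j else if j < i then P'⁻¹ j else 0
  obtain ⟨x, hx, hK⟩ := exists_mulVec_eq_zero_iff.2
    (det_eq_zero_of_row_eq_zero (A := K) i fun j => by simp [K])
  have ha : ∀ j, i < j → (P⁻¹ *ᵥ x) j = 0 := fun j hj => by
    simpa [K, mulVec, hj] using congrFun hK j
  have hb : ∀ j, j < i → (P'⁻¹ *ᵥ x) j = 0 := fun j hj => by
    simpa [K, mulVec, hj, hj.not_gt] using congrFun hK j
  have hxa : P *ᵥ (P⁻¹ *ᵥ x) = x := by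
    rw [mulVec_mulVec, inv_eq_left_inv hPY, mul_eq_one_comm.1 hPY, one_mulVec]
  have hxb : P' *ᵥ (P'⁻¹ *ᵥ x) = x := by
    rw [mulVec_mulVec, inv_eq_left_inv hPY', mul_eq_one_comm.1 hPY', one_mulVec]
  rw [← diagonal_one] at hPY hPY'
  have e1 := dotProduct_mulVec_congr hPY (P⁻¹ *ᵥ x)
  have e2 := dotProduct_mulVec_congr hPX (P⁻¹ *ᵥ x)
  have e3 := dotProduct_mulVec_congr hPY' (P'⁻¹ *ᵥ x)
  have e4 := dotProduct_mulVec_congr hPX' (P'⁻¹ *ᵥ x)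
  rw [hxa] at e1 e2
  rw [hxb] at e3 e4
  refine ⟨x, hx, ?_, ?_⟩
  · rw [e1, e2, Finset.mul_sum]
    refine Finset.sum_le_sum fun j _ => ?_
    rcases lt_or_ge i j with hj | hj
    · simp [ha j hj]
    · rw [one_mul]
      exact mul_le_mul_of_nonneg_right (hd hj) (sq_nonneg _)
  · rw [e3, e4, Finset.mul_sum]
    refine Finset.sum_le_sum fun j _ => ?_
    rcases lt_or_ge j i with hj | hj
    · simp [hb j hj]
    · rw [one_mul]
      exact mul_le_mul_of_nonneg_right (hd' hj) (sq_nonneg _)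

theorem sq_log_le_sq_log {a b : ℝ} (ha : 0 < a) (hb : 0 < b) (h1 : b ≤ max 1 a)
    (h2 : min 1 a ≤ b) : Real.log b ^ 2 ≤ Real.log a ^ 2 := by
  rcases le_total 1 a with h | h
  · rw [max_eq_right h] at h1
    rw [min_eq_left h] at h2
    exact pow_le_pow_left₀ (Real.log_nonneg h2) (Real.log_le_log hb h1) 2
  · rw [max_eq_left h] at h1
    rw [min_eq_right h] at h2
    have := Real.log_le_log ha h2
    have := Real.log_nonpos hb.le h1
    nlinarith

theorem riemannianDist_add_le {n : ℕ} {X Y S : Matrix (Fin n) (Fin n) ℝ}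
    (hX : X.PosDef) (hY : Y.PosDef) (hS : S.PosSemidef) :
    riemannianDist (X + S) (Y + S) ≤ riemannianDist X Y := by
  have hXS := hX.add_posSemidef hS
  have hYS := hY.add_posSemidef hS
  obtain ⟨P, d, hmono, hd, hPY, hPX⟩ := exists_simultaneous_diagonalization hX hY
  obtain ⟨P', d', hmono', hd', hPY', hPX'⟩ := exists_simultaneous_diagonalization hXS hYS
  rw [riemannianDist_eq_of_diagonalization hPY hPX,
    riemannianDist_eq_of_diagonalization hPY' hPX']
  refine Real.sqrt_le_sqrt (Finset.sum_le_sum fun i _ => sq_log_le_sq_log (hd i) (hd' i) ?_ ?_)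
  · obtain ⟨x, hx, h1, h2⟩ := exists_common_test_vector hmono hmono' hPY hPX hPY' hPX' i
    have hy : 0 < x ⬝ᵥ Y *ᵥ x := hY.dotProduct_mulVec_pos hx
    have hs : 0 ≤ x ⬝ᵥ S *ᵥ x := hS.dotProduct_mulVec_nonneg x
    rw [add_mulVec, add_mulVec, dotProduct_add, dotProduct_add] at h2
    refine le_of_mul_le_mul_right ?_ (add_pos_of_pos_of_nonneg hy hs)
    have := mul_le_mul_of_nonneg_right (le_max_right 1 (d i)) hy.le
    have := mul_le_mul_of_nonneg_right (le_max_left 1 (d i)) hs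
    linarith
  · obtain ⟨x, hx, h1, h2⟩ := exists_common_test_vector hmono' hmono hPY' hPX' hPY hPX i
    have hy : 0 < x ⬝ᵥ Y *ᵥ x := hY.dotProduct_mulVec_pos hx
    have hs : 0 ≤ x ⬝ᵥ S *ᵥ x := hS.dotProduct_mulVec_nonneg x
    rw [add_mulVec, add_mulVec, dotProduct_add, dotProduct_add] at h1
    refine le_of_mul_le_mul_right ?_ (add_pos_of_pos_of_nonneg hy hs)
    have := mul_le_mul_of_nonneg_right (min_le_right 1 (d i)) hy.le
    have := mul_le_mul_of_nonneg_right (min_le_left 1 (d i)) hs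
    linarith

theorem posSemidef_mul_inv_mul_transpose {n m : ℕ} (B : Matrix (Fin n) (Fin m) ℝ)
    {R : Matrix (Fin m) (Fin m) ℝ} (hR : R.PosDef) : (B * R⁻¹ * Bᵀ).PosSemidef := by
  simpa using hR.inv.posSemidef.mul_mul_conjTranspose_same B

/-- The Woodbury form of the Riccati operator. -/
theorem ricOp_eq_add_inv {n m : ℕ} (A Q : Matrix (Fin n) (Fin n) ℝ)
    (B : Matrix (Fin n) (Fin m) ℝ) {R : Matrix (Fin m) (Fin m) ℝ} (hR : R.PosDef)
    {P : Matrix (Fin n) (Fin n) ℝ} (hP : P.PosDef) :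
    ricOp A Q B R P = Aᵀ * (P⁻¹ + B * R⁻¹ * Bᵀ)⁻¹ * A + Q := by
  have hPi : P⁻¹⁻¹ = P := nonsing_inv_nonsing_inv _ ((isUnit_iff_isUnit_det _).1 hP.isUnit)
  have hRi : R⁻¹⁻¹ = R := nonsing_inv_nonsing_inv _ ((isUnit_iff_isUnit_det _).1 hR.isUnit)
  have hU : IsUnit (R⁻¹⁻¹ + Bᵀ * P⁻¹⁻¹ * B) := by
    rw [hPi, hRi]
    have h : (Bᵀ * P * B).PosSemidef := by
      simpa using hP.posSemidef.conjTranspose_mul_mul_same B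
    exact (hR.add_posSemidef h).isUnit
  rw [add_mul_mul_inv_eq_sub _ _ _ _ hP.inv.isUnit hR.inv.isUnit hU, hPi, hRi, ricOp, add_comm]

/-- The Riccati operator is nonexpansive with respect to the Riemannian
distance on symmetric positive definite matrices. -/
theorem riccati_nonexpansive {n m : ℕ}
    (A Q : Matrix (Fin n) (Fin n) ℝ) (B : Matrix (Fin n) (Fin m) ℝ)
    (R : Matrix (Fin m) (Fin m) ℝ)
    (hA : IsUnit A.det) (hQ : Q.PosSemidef) (hR : R.PosDef) :
    ∀ X Y : Matrix (Fin n) (Fin n) ℝ, X.PosDef → Y.PosDef →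
      riemannianDist (ricOp A Q B R X) (ricOp A Q B R Y) ≤ riemannianDist X Y := by
  intro X Y hX hY
  have hS := posSemidef_mul_inv_mul_transpose B hR
  have hX' := hX.inv.add_posSemidef hS
  have hY' := hY.inv.add_posSemidef hS
  have hcongr : ∀ {P : Matrix (Fin n) (Fin n) ℝ}, P.PosDef → (Aᵀ * P * A).PosDef := fun hP => by
    simpa using hP.conjTranspose_mul_mul_same
      (mulVec_injective_iff_isUnit.2 ((isUnit_iff_isUnit_det A).2 hA))
  rw [ricOp_eq_add_inv A Q B hR hX, ricOp_eq_add_inv A Q B hR hY]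
  calc _ ≤ _ := riemannianDist_add_le (hcongr hX'.inv) (hcongr hY'.inv) hQ
    _ = _ := riemannianDist_congr hA _ _
    _ = _ := riemannianDist_inv hX' hY'
    _ ≤ _ := riemannianDist_add_le hX.inv hY.inv hS
    _ = _ := riemannianDist_inv hX hY
end

section
/- Let A be an invertible n×n real matrix, B an n×m real matrix, Q an n×n real symmetric positive semidefinite matrix, and R an m×m real symmetric positive definite matrix. With E := Aᵀ + Q A⁻¹ B R⁻¹ Bᵀ and G := A⁻¹ B R⁻¹ Bᵀ, the matrix E is invertible and (Eᵀ)⁻¹ Gᵀ = A⁻¹ B (R + Bᵀ (Aᵀ)⁻¹ Q A⁻¹ B)⁻¹ Bᵀ (Aᵀ)⁻¹. -/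
open Matrix

/-- If `R` and `R + Cᵀ Q C` are invertible, then so is `1 + Q C R⁻¹ Cᵀ`. -/
lemma Matrix.isUnit_det_one_add_mul_inv_mul_transpose {ι κ α : Type*} [Fintype ι] [DecidableEq ι]
    [Fintype κ] [DecidableEq κ] [CommRing α] {Q : Matrix ι ι α} {C : Matrix ι κ α}
    {R : Matrix κ κ α} (hR : IsUnit R.det) (hS : IsUnit (R + Cᵀ * Q * C).det) :
    IsUnit (1 + Q * C * R⁻¹ * Cᵀ).det := by
  have h : 1 + Cᵀ * (Q * C * R⁻¹) = (R + Cᵀ * Q * C) * R⁻¹ := by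
    rw [Matrix.add_mul, Matrix.mul_nonsing_inv _ hR]
    simp only [Matrix.mul_assoc]
  rw [Matrix.det_one_add_mul_comm, h, Matrix.det_mul]
  exact hS.mul (Matrix.isUnit_nonsing_inv_det _ hR)

/-- The push-through identity `(1 + C R⁻¹ Cᵀ Q) C (R + Cᵀ Q C)⁻¹ = C R⁻¹`. -/
lemma Matrix.one_add_mul_mul_inv_add {ι κ α : Type*} [Fintype ι] [DecidableEq ι]
    [Fintype κ] [DecidableEq κ] [CommRing α] {Q : Matrix ι ι α} {C : Matrix ι κ α}
    {R : Matrix κ κ α} (hR : IsUnit R.det) (hS : IsUnit (R + Cᵀ * Q * C).det) :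
    (1 + C * R⁻¹ * Cᵀ * Q) * C * (R + Cᵀ * Q * C)⁻¹ = C * R⁻¹ := by
  have h : (1 + C * R⁻¹ * Cᵀ * Q) * C = C * R⁻¹ * (R + Cᵀ * Q * C) := by
    rw [Matrix.mul_add, Matrix.nonsing_inv_mul_cancel_right _ _ hR, Matrix.add_mul, Matrix.one_mul]
    simp only [Matrix.mul_assoc]
  rw [h, Matrix.mul_nonsing_inv_cancel_right _ _ hS]

/-- With `E = Aᵀ + Q A⁻¹ B R⁻¹ Bᵀ` and `G = A⁻¹ B R⁻¹ Bᵀ`, `E` is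
invertible and `(Eᵀ)⁻¹ Gᵀ = A⁻¹ B (R + Bᵀ (Aᵀ)⁻¹ Q A⁻¹ B)⁻¹ Bᵀ (Aᵀ)⁻¹`. -/
theorem EtInv_Gt_identity {n m : ℕ}
    (A Q : Matrix (Fin n) (Fin n) ℝ) (B : Matrix (Fin n) (Fin m) ℝ)
    (R : Matrix (Fin m) (Fin m) ℝ)
    (hA : IsUnit A.det) (hQ : Q.PosSemidef) (hR : R.PosDef) :
    IsUnit (Aᵀ + Q * A⁻¹ * B * R⁻¹ * Bᵀ).det ∧
      ((Aᵀ + Q * A⁻¹ * B * R⁻¹ * Bᵀ)ᵀ)⁻¹ * (A⁻¹ * B * R⁻¹ * Bᵀ)ᵀ =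
        A⁻¹ * B * (R + Bᵀ * Aᵀ⁻¹ * Q * A⁻¹ * B)⁻¹ * Bᵀ * Aᵀ⁻¹ := by
  obtain ⟨C, rfl⟩ : ∃ C, B = A * C := ⟨A⁻¹ * B, (Matrix.mul_nonsing_inv_cancel_left _ _ hA).symm⟩
  have hAt : IsUnit Aᵀ.det := A.isUnit_det_transpose hA
  have hRu : IsUnit R.det := hR.det_pos.ne'.isUnit
  have hQt : Qᵀ = Q := by simpa using hQ.isHermitian.eq
  have hRt : Rᵀ = R := by simpa using hR.isHermitian.eq
  have hS : IsUnit (R + Cᵀ * Q * C).det := by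
    have h := hQ.conjTranspose_mul_mul_same C
    rw [Matrix.conjTranspose_eq_transpose_of_trivial] at h
    exact (hR.add_posSemidef h).det_pos.ne'.isUnit
  have hE : Aᵀ + Q * A⁻¹ * (A * C) * R⁻¹ * (A * C)ᵀ = (1 + Q * C * R⁻¹ * Cᵀ) * Aᵀ := by
    rw [Matrix.mul_assoc Q, Matrix.nonsing_inv_mul_cancel_left _ _ hA, Matrix.transpose_mul,
      Matrix.add_mul, Matrix.one_mul]
    simp only [Matrix.mul_assoc]
  have hEu : IsUnit ((1 + Q * C * R⁻¹ * Cᵀ) * Aᵀ).det := by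
    rw [Matrix.det_mul]
    exact (Matrix.isUnit_det_one_add_mul_inv_mul_transpose hRu hS).mul hAt
  have hEt : ((1 + Q * C * R⁻¹ * Cᵀ) * Aᵀ)ᵀ = A * (1 + C * R⁻¹ * Cᵀ * Q) := by
    simp [Matrix.transpose_mul, Matrix.transpose_nonsing_inv, hQt, hRt, Matrix.mul_assoc]
  have hG : (A⁻¹ * (A * C) * R⁻¹ * (A * C)ᵀ)ᵀ = A * (C * R⁻¹) * Cᵀ := by
    rw [Matrix.nonsing_inv_mul_cancel_left _ _ hA]
    simp [Matrix.transpose_mul, Matrix.transpose_nonsing_inv, hRt, Matrix.mul_assoc]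
  have hSe : R + (A * C)ᵀ * Aᵀ⁻¹ * Q * A⁻¹ * (A * C) = R + Cᵀ * Q * C := by
    rw [Matrix.transpose_mul, Matrix.mul_nonsing_inv_cancel_right _ _ hAt, Matrix.mul_assoc _ A⁻¹,
      Matrix.nonsing_inv_mul_cancel_left _ _ hA]
  have hEtu := Matrix.isUnit_det_transpose _ hEu
  rw [hE, hG, hSe]
  refine ⟨hEu, ?_⟩
  rw [Matrix.nonsing_inv_mul_cancel_left _ _ hA, Matrix.transpose_mul A C,
    ← Matrix.mul_assoc _ Cᵀ Aᵀ,
    Matrix.mul_nonsing_inv_cancel_right _ _ hAt, ← Matrix.one_add_mul_mul_inv_add hRu hS]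
  rw [hEt] at hEtu ⊢
  rw [← Matrix.nonsing_inv_mul_cancel_left _ (C * (R + Cᵀ * Q * C)⁻¹ * Cᵀ) hEtu]
  simp only [Matrix.mul_assoc]
end

section
/- Let d ≥ 1, let (A_k) be invertible n×n real matrices, (B_k) n×m real matrices, and (C_k) n×n real matrices. Fix t ∈ ℕ₀ and define: Φ_t := A_{d(t+1)-1} ⋯ A_{dt}; Γ_t the n×md matrix whose j-th n×m block (j = 0,…,d−1) is A_{d(t+1)-1} ⋯ A_{dt+j+1} B_{dt+j}; Ξ_t the nd×n matrix whose i-th n×n block is C_{dt+i} A_{dt+i-1} ⋯ A_{dt}; and Δ_t the nd×md matrix with (i,j) block C_{dt+i} A_{dt+i-1} ⋯ A_{dt+j+1} B_{dt+j} for i > j and 0 for i ≤ j. Then the (i,j) n×m block of Ξ_t Φ_t⁻¹ Γ_t − Δ_t equals C_{dt+i} (A_{dt+j} A_{dt+j-1} ⋯ A_{dt+i})⁻¹ B_{dt+j} for j ≥ i and equals 0 for j < i; in particular, Ξ_t Φ_t⁻¹ Γ_t − Δ_t is block upper triangular and Δ_tᵀ Δ_t − Δ_tᵀ Ξ_t Φ_t⁻¹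 Γ_t is block upper triangular with all d diagonal m×m blocks equal to zero. -/
open Matrix

/-- Descending product `prodDesc A a k = A (a+k-1) * ⋯ * A (a+1) * A a`
(the empty product being the identity). -/
def prodDesc {n : ℕ} (A : ℕ → Matrix (Fin n) (Fin n) ℝ) (a : ℕ) :
    ℕ → Matrix (Fin n) (Fin n) ℝ
  | 0 => 1
  | k + 1 => A (a + k) * prodDesc A a k

/-- The `d`-step controllability matrix `Γ_t`: its `j`-th `n × m` block is
`A (d(t+1)-1) * ⋯ * A (dt+j+1) * B (dt+j)`. -/
def GammaM {n m : ℕ} (A : ℕ → Matrix (Fin n) (Fin n) ℝ)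
    (B : ℕ → Matrix (Fin n) (Fin m) ℝ) (d t : ℕ) :
    Matrix (Fin n) (Fin d × Fin m) ℝ :=
  fun p jq => (prodDesc A (d * t + jq.1 + 1) (d - jq.1 - 1) * B (d * t + jq.1)) p jq.2

/-- The `d`-step observability matrix `Ξ_t`: its `i`-th `n × n` block is
`C (dt+i) * A (dt+i-1) * ⋯ * A (dt)`. -/
def XiM {n : ℕ} (A C : ℕ → Matrix (Fin n) (Fin n) ℝ) (d t : ℕ) :
    Matrix (Fin d × Fin n) (Fin n) ℝ :=
  fun ip q => (C (d * t + ip.1) * prodDesc A (d * t) ip.1) ip.2 q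

/-- The block matrix `Δ_t`: its `(i,j)` block is
`C (dt+i) * A (dt+i-1) * ⋯ * A (dt+j+1) * B (dt+j)` for `i > j`, and `0` for `i ≤ j`. -/
def DeltaM {n m : ℕ} (A C : ℕ → Matrix (Fin n) (Fin n) ℝ)
    (B : ℕ → Matrix (Fin n) (Fin m) ℝ) (d t : ℕ) :
    Matrix (Fin d × Fin n) (Fin d × Fin m) ℝ :=
  fun ip jq =>
    if (jq.1 : ℕ) < (ip.1 : ℕ) then
      (C (d * t + ip.1) * prodDesc A (d * t + jq.1 + 1) (ip.1 - jq.1 - 1) *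
        B (d * t + jq.1)) ip.2 jq.2
    else 0

theorem prodDesc_add {n : ℕ} (A : ℕ → Matrix (Fin n) (Fin n) ℝ) (a k l : ℕ) :
    prodDesc A a (k + l) = prodDesc A (a + k) l * prodDesc A a k := by
  induction l with
  | zero => simp [prodDesc]
  | succ l ih =>
    rw [← Nat.add_assoc, prodDesc, prodDesc, ih, Matrix.mul_assoc, Nat.add_assoc]

theorem isUnit_det_prodDesc {n : ℕ} {A : ℕ → Matrix (Fin n) (Fin n) ℝ}
    (hA : ∀ k, IsUnit (A k).det) (a k : ℕ) : IsUnit (prodDesc A a k).det := by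
  induction k with
  | zero => simp [prodDesc]
  | succ k ih => simpa only [prodDesc, Matrix.det_mul] using (hA _).mul ih

theorem inv_prodDesc_mul_prodDesc {n : ℕ} {A : ℕ → Matrix (Fin n) (Fin n) ℝ}
    (hA : ∀ k, IsUnit (A k).det) (a k l : ℕ) :
    (prodDesc A a (k + l))⁻¹ * prodDesc A (a + k) l = (prodDesc A a k)⁻¹ := by
  rw [prodDesc_add, Matrix.mul_inv_rev, Matrix.mul_assoc,
    Matrix.nonsing_inv_mul _ (isUnit_det_prodDesc hA _ _), Matrix.mul_one]

theorem prodDesc_mul_inv_prodDesc {n : ℕ} {A : ℕ → Matrix (Fin n) (Fin n) ℝ}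
    (hA : ∀ k, IsUnit (A k).det) (a k l : ℕ) :
    prodDesc A a k * (prodDesc A a (k + l))⁻¹ = (prodDesc A (a + k) l)⁻¹ := by
  rw [prodDesc_add, Matrix.mul_inv_rev, ← Matrix.mul_assoc,
    Matrix.mul_nonsing_inv _ (isUnit_det_prodDesc hA _ _), Matrix.one_mul]

theorem prodDesc_add_mul_inv_prodDesc {n : ℕ} {A : ℕ → Matrix (Fin n) (Fin n) ℝ}
    (hA : ∀ k, IsUnit (A k).det) (a k l : ℕ) :
    prodDesc A a (k + l) * (prodDesc A a k)⁻¹ = prodDesc A (a + k) l := by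
  rw [prodDesc_add, Matrix.mul_assoc,
    Matrix.mul_nonsing_inv _ (isUnit_det_prodDesc hA _ _), Matrix.mul_one]

theorem XiM_mul_mul_GammaM_apply {n m : ℕ} (A C : ℕ → Matrix (Fin n) (Fin n) ℝ)
    (B : ℕ → Matrix (Fin n) (Fin m) ℝ) (d t : ℕ) (M : Matrix (Fin n) (Fin n) ℝ)
    (i j : Fin d) (p : Fin n) (q : Fin m) :
    (XiM A C d t * M * GammaM A B d t) (i, p) (j, q) =
      (C (d * t + i) * prodDesc A (d * t) i * M *
        (prodDesc A (d * t + j + 1) (d - j - 1) * B (d * t + j))) p q := by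
  simp only [Matrix.mul_apply, XiM, GammaM]

theorem XiM_mul_inv_mul_GammaM_sub_DeltaM_apply {n m : ℕ} (d t : ℕ)
    (A C : ℕ → Matrix (Fin n) (Fin n) ℝ) (B : ℕ → Matrix (Fin n) (Fin m) ℝ)
    (hA : ∀ k, IsUnit (A k).det) (i j : Fin d) (p : Fin n) (q : Fin m) :
    (XiM A C d t * (prodDesc A (d * t) d)⁻¹ * GammaM A B d t -
      DeltaM A C B d t) (i, p) (j, q) =
      if (i : ℕ) ≤ (j : ℕ) then
        (C (d * t + i) * (prodDesc A (d * t + i) ((j : ℕ) - i + 1))⁻¹ *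
          B (d * t + j)) p q
      else 0 := by
  have hΦ : (prodDesc A (d * t) d)⁻¹ * prodDesc A (d * t + j + 1) (d - j - 1) =
      (prodDesc A (d * t) (j + 1))⁻¹ := by
    have h := inv_prodDesc_mul_prodDesc hA (d * t) (j + 1) (d - j - 1)
    rwa [show (j : ℕ) + 1 + (d - j - 1) = d by omega, ← Nat.add_assoc] at h
  have hblock : C (d * t + i) * prodDesc A (d * t) i * (prodDesc A (d * t) d)⁻¹ *
      (prodDesc A (d * t + j + 1) (d - j - 1) * B (d * t + j)) =
      C (d * t + i) * (prodDesc A (d * t) i * (prodDesc A (d * t) (j + 1))⁻¹) *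
        B (d * t + j) := by
    rw [← hΦ]
    simp only [Matrix.mul_assoc]
  rw [Matrix.sub_apply, XiM_mul_mul_GammaM_apply, hblock]
  by_cases hij : (i : ℕ) ≤ j
  · have h := prodDesc_mul_inv_prodDesc hA (d * t) i (j - i + 1)
    rw [show (i : ℕ) + (j - i + 1) = j + 1 by omega] at h
    simp [DeltaM, hij, not_lt.mpr hij, h]
  · have h := prodDesc_add_mul_inv_prodDesc hA (d * t) (j + 1) (i - j - 1)
    rw [show (j : ℕ) + 1 + (i - j - 1) = i by omega, ← Nat.add_assoc] at h
    simp [DeltaM, hij, not_le.mp hij, h]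

/-- The `(i,j)` block of `Ξ_t Φ_t⁻¹ Γ_t − Δ_t` is
`C (dt+i) * (A (dt+j) ⋯ A (dt+i))⁻¹ * B (dt+j)` for `j ≥ i` and `0` for `j < i`; in
particular `Ξ_t Φ_t⁻¹ Γ_t − Δ_t` is block upper triangular and
`Δ_tᵀ Δ_t − Δ_tᵀ Ξ_t Φ_t⁻¹ Γ_t` is block upper triangular with zero diagonal blocks. -/
theorem block_structure {n m : ℕ} (d : ℕ) (hd : 1 ≤ d) (t : ℕ)
    (A C : ℕ → Matrix (Fin n) (Fin n) ℝ) (B : ℕ → Matrix (Fin n) (Fin m) ℝ)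
    (hA : ∀ k, IsUnit (A k).det) :
    (∀ (i j : Fin d) (p : Fin n) (q : Fin m),
        (XiM A C d t * (prodDesc A (d * t) d)⁻¹ * GammaM A B d t -
          DeltaM A C B d t) (i, p) (j, q) =
          if (i : ℕ) ≤ (j : ℕ) then
            (C (d * t + i) * (prodDesc A (d * t + i) ((j : ℕ) - i + 1))⁻¹ *
              B (d * t + j)) p q
          else 0) ∧
    (∀ (i j : Fin d), (j : ℕ) < (i : ℕ) → ∀ (p : Fin n) (q : Fin m),
        (XiM A C d t * (prodDesc A (d * t) d)⁻¹ * GammaM A B d t -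
          DeltaM A C B d t) (i, p) (j, q) = 0) ∧
    (∀ (i j : Fin d), (j : ℕ) ≤ (i : ℕ) → ∀ (p q : Fin m),
        ((DeltaM A C B d t)ᵀ * DeltaM A C B d t -
          (DeltaM A C B d t)ᵀ *
            (XiM A C d t * (prodDesc A (d * t) d)⁻¹ * GammaM A B d t)) (i, p) (j, q)
          = 0) := by
  have hM := XiM_mul_inv_mul_GammaM_sub_DeltaM_apply d t A C B hA
  refine ⟨hM, fun i j hij p q => by rw [hM, if_neg (not_le.mpr hij)], fun i j hij p q => ?_⟩
  rw [← Matrix.mul_sub, ← neg_sub, Matrix.mul_neg, Matrix.neg_apply, neg_eq_zero,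
    Matrix.mul_apply]
  refine Finset.sum_eq_zero fun ⟨k, r⟩ _ => ?_
  rw [hM, Matrix.transpose_apply]
  by_cases hkj : (k : ℕ) ≤ j
  · simp [DeltaM, not_lt.mpr (hkj.trans hij)]
  · rw [if_neg hkj, mul_zero]
end
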